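/- Let R be an integral domain, G a group of the form G = A ⋊ ℤ with A finitely generated, and φ : G → ℤ the projection. Then for every k ≤ 1, the k-th homology H_k(G; R[t,t⁻¹]), where R[t,t⁻¹] is the RG-module with g acting by multiplication by t^{φ(g)}, is a torsion R[t,t⁻¹]-module. (Special case: H_k(G; R[t,t⁻¹]) ≅ H_k(A; R) as R-modules, which is finitely generated over R.) -/

import Mathlib

open LaurentPolynomial

noncomputable section BarComplex

variable (R : Type*) [CommRing R] (G : Type*) [Group G] (φ : G →* Multiplicative ℤ)

/-- First differential of the bar complex computing `H_*(G; R[t,t⁻¹])`, where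
`R[t,t⁻¹]` is the `RG`-module on which `g` acts by multiplication by `t^{φ(g)}`:
`d₁(x ⊗ [g]) = x·t^{φ(g)} - x`. -/
def barD1 : (G →₀ LaurentPolynomial R) →ₗ[LaurentPolynomial R] LaurentPolynomial R :=
  Finsupp.lsum (LaurentPolynomial R) fun g =>
    LinearMap.mulLeft (LaurentPolynomial R) (T (Multiplicative.toAdd (φ g))) -
      LinearMap.id

/-- Second differential of the bar complex computing `H_*(G; R[t,t⁻¹])`:
`d₂(x ⊗ [g|h]) = x·t^{φ(g)} ⊗ [h] - x ⊗ [gh] + x ⊗ [g]`. -/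
def barD2 : (G × G →₀ LaurentPolynomial R) →ₗ[LaurentPolynomial R]
    (G →₀ LaurentPolynomial R) :=
  Finsupp.lsum (LaurentPolynomial R) fun p =>
    (Finsupp.lsingle p.2).comp
        (LinearMap.mulLeft (LaurentPolynomial R) (T (Multiplicative.toAdd (φ p.1)))) -
      Finsupp.lsingle (p.1 * p.2) + Finsupp.lsingle p.1

/-- Zeroth homology `H₀(G; R[t,t⁻¹])` of the bar complex (the coinvariants). -/
abbrev barHomology0 := LaurentPolynomial R ⧸ LinearMap.range (barD1 R G φ)

/-- First homology `H₁(G; R[t,t⁻¹])` of the bar complex: the image of the `1`-cycles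
in the quotient of the `1`-chains by the `1`-boundaries (since boundaries are cycles,
this is cycles modulo boundaries). -/
abbrev barHomology1 := ↥(Submodule.map (LinearMap.range (barD2 R G φ)).mkQ
    (LinearMap.ker (barD1 R G φ)))

end BarComplex

/-- Cayley–Hamilton: a finitely generated `R`-submodule stable under `t` is annihilated by a
monic polynomial in `t`. -/
theorem exists_monic_toLaurent_smul_eq_zero {R M : Type*} [CommRing R] [AddCommGroup M]
    [Module R M] [Module (LaurentPolynomial R) M] [IsScalarTower R (LaurentPolynomial R) M]
    (N : Submodule R M) (hN : N.FG) (hT : ∀ x ∈ N, (T 1 : LaurentPolynomial R) • x ∈ N) :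
    ∃ p : Polynomial R, p.Monic ∧ ∀ x ∈ N, p.toLaurent • x = 0 := by
  have : Module.Finite R N := Module.Finite.iff_fg.mpr hN
  let f : Module.End R N := (Algebra.lsmul R R M (T 1 : LaurentPolynomial R)).restrict hT
  have hpow (n : ℕ) : ∀ x : N, (((f ^ n) x : N) : M) = (T n : LaurentPolynomial R) • (x : M) := by
    induction n with
    | zero => intro x; simp
    | succ n ih =>
      intro x
      rw [pow_succ, Module.End.mul_apply, ih]
      rw [Nat.cast_succ, T_add, mul_smul]
      rfl
  have hf (p : Polynomial R) :
      ∀ x : N, ((Polynomial.aeval f p x : N) : M) = p.toLaurent • (x : M) := by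
    induction p using Polynomial.induction_on' with
    | add p q hp hq => intro x; simp [hp, hq, add_smul]
    | monomial n a =>
      intro x
      rw [Polynomial.aeval_monomial, ← Polynomial.C_mul_X_pow_eq_monomial,
        Polynomial.toLaurent_C_mul_X_pow, mul_smul,
        Module.End.mul_apply, Module.algebraMap_end_apply, Submodule.coe_smul, hpow,
        show C a = algebraMap R (LaurentPolynomial R) a from rfl, algebraMap_smul]
  obtain ⟨p, hp, hpf⟩ := LinearMap.exists_monic_and_aeval_eq_zero R f
  exact ⟨p, hp, fun x hx => by simpa [hpf] using (hf p ⟨x, hx⟩).symm⟩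

section Bar

variable {R G : Type*} [CommRing R] [Group G] {φ : G →* Multiplicative ℤ}

theorem barD1_single (g : G) (x : LaurentPolynomial R) :
    barD1 R G φ (Finsupp.single g x) = T (φ g).toAdd * x - x := by
  simp [barD1, mul_comm]

theorem barD2_single (g h : G) (x : LaurentPolynomial R) :
    barD2 R G φ (Finsupp.single (g, h) x) =
      Finsupp.single h (T (φ g).toAdd * x) - Finsupp.single (g * h) x + Finsupp.single g x := by
  simp [barD2]

variable (R φ) in
/-- The class of the `1`-chain `1 ⊗ [g]` modulo the `1`-boundaries. -/
noncomputable def barClass (g : G) :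
    (G →₀ LaurentPolynomial R) ⧸ LinearMap.range (barD2 R G φ) :=
  Submodule.Quotient.mk (Finsupp.single g 1)

theorem barClass_mul (g h : G) :
    barClass R φ (g * h) =
      barClass R φ g + (T (φ g).toAdd : LaurentPolynomial R) • barClass R φ h := by
  have key : (Submodule.Quotient.mk (barD2 R G φ (Finsupp.single (g, h) 1)) :
      (G →₀ LaurentPolynomial R) ⧸ LinearMap.range (barD2 R G φ)) = 0 :=
    (Submodule.Quotient.mk_eq_zero _).mpr ⟨_, rfl⟩
  rw [barD2_single, ← smul_eq_mul, ← Finsupp.smul_single, Submodule.Quotient.mk_add,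
    Submodule.Quotient.mk_sub, Submodule.Quotient.mk_smul] at key
  unfold barClass
  rw [← sub_eq_zero, ← neg_eq_zero, ← key]
  abel

theorem barClass_one : barClass R φ (1 : G) = 0 := by
  simpa using barClass_mul (R := R) (φ := φ) (1 : G) 1

theorem smul_barClass_inv (g : G) :
    (T (φ g).toAdd : LaurentPolynomial R) • barClass R φ g⁻¹ = -barClass R φ g := by
  have h := barClass_mul (R := R) (φ := φ) g g⁻¹
  rw [mul_inv_cancel, barClass_one] at h
  exact (neg_eq_of_add_eq_zero_right h.symm).symm

theorem barClass_conj (s a : G) (ha : φ a = 1) :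
    barClass R φ (s * a * s⁻¹) = (T (φ s).toAdd : LaurentPolynomial R) • barClass R φ a := by
  rw [barClass_mul, barClass_mul, map_mul, ha, mul_one, smul_barClass_inv]
  abel

theorem smul_barClass_comm (g h : G) (hgh : Commute g h) :
    (T (φ g).toAdd - 1 : LaurentPolynomial R) • barClass R φ h =
      (T (φ h).toAdd - 1 : LaurentPolynomial R) • barClass R φ g := by
  have h1 := barClass_mul (R := R) (φ := φ) g h
  rw [hgh.eq, barClass_mul] at h1
  rw [sub_smul, sub_smul, one_smul, one_smul, sub_eq_sub_iff_add_eq_add, add_comm, ← h1, add_comm]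

theorem T_sub_one_mul_smul_mk_eq_zero {s : G} (hs : (φ s).toAdd = 1) {q : LaurentPolynomial R}
    (hq : ∀ a, φ a = 1 → q • barClass R φ a = 0) {c : G →₀ LaurentPolynomial R}
    (hc : barD1 R G φ c = 0) :
    (q * (T 1 - 1)) • (LinearMap.range (barD2 R G φ)).mkQ c = 0 := by
  have key : (q * (T 1 - 1)) • (LinearMap.range (barD2 R G φ)).mkQ =
      (LinearMap.toSpanSingleton (LaurentPolynomial R) _ (q • barClass R φ s)).comp
        (barD1 R G φ) := by
    refine Finsupp.lhom_ext' fun g => LinearMap.ext_ring ?_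
    let n := (φ g).toAdd
    have hφ : (φ (s ^ n)).toAdd = n := by simp [hs]
    have ha : φ (g * (s ^ n)⁻¹) = 1 := by
      rw [map_mul, map_inv, mul_inv_eq_one]
      exact hφ.symm
    have hg : barClass R φ g = barClass R φ (g * (s ^ n)⁻¹) + barClass R φ (s ^ n) := by
      conv_lhs => rw [← inv_mul_cancel_right g (s ^ n), barClass_mul, ha]
      simp
    have hcomm := smul_barClass_comm (R := R) (φ := φ) s (s ^ n) (Commute.self_zpow s n)
    rw [hs, hφ] at hcomm
    change (q * (T 1 - 1)) • barClass R φ g =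
      barD1 R G φ (Finsupp.single g 1) • q • barClass R φ s
    rw [barD1_single, mul_one, hg, smul_add, mul_comm q, mul_smul, hq _ ha, smul_zero, zero_add,
      mul_comm, mul_smul, hcomm, smul_comm]
  have h := LinearMap.congr_fun key c
  simpa [hc] using h

theorem exists_monic_smul_barClass_eq_zero {s : G} (hs : (φ s).toAdd = 1) (hfg : φ.ker.FG) :
    ∃ p : Polynomial R, p.Monic ∧ ∀ a, φ a = 1 → p.toLaurent • barClass R φ a = 0 := by
  obtain ⟨S, hS⟩ := hfg
  let N := Submodule.span R (barClass R φ '' (S : Set G))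
  have hmem : ∀ a, φ a = 1 → barClass R φ a ∈ N := by
    intro a ha
    have haS : a ∈ Subgroup.closure (S : Set G) := hS ▸ ha
    induction haS using Subgroup.closure_induction with
    | mem x hx => exact Submodule.subset_span ⟨x, hx, rfl⟩
    | one => rw [barClass_one]; exact N.zero_mem
    | mul x y hx hy ihx ihy =>
      have hx1 : φ x = 1 := by rwa [hS] at hx
      have hy1 : φ y = 1 := by rwa [hS] at hy
      rw [barClass_mul, hx1, toAdd_one, T_zero, one_smul]
      exact N.add_mem (ihx hx1) (ihy hy1)
    | inv x hx ih =>
      have hx1 : φ x = 1 := by rwa [hS] at hx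
      have h := smul_barClass_inv (R := R) (φ := φ) x
      rw [hx1, toAdd_one, T_zero, one_smul] at h
      rw [h]
      exact N.neg_mem (ih hx1)
  have hT : ∀ x ∈ N, (T 1 : LaurentPolynomial R) • x ∈ N := by
    intro x hx
    induction hx using Submodule.span_induction with
    | mem x hx =>
      obtain ⟨a, ha, rfl⟩ := hx
      have ha1 : φ a = 1 := by
        have : a ∈ φ.ker := hS ▸ Subgroup.subset_closure ha
        exact this
      rw [← hs, ← barClass_conj s a ha1]
      exact hmem _ (by simp [ha1])
    | zero => rw [smul_zero]; exact N.zero_mem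
    | add x y _ _ hx hy => rw [smul_add]; exact N.add_mem hx hy
    | smul r x _ hx => rw [smul_comm]; exact N.smul_mem r hx
  obtain ⟨p, hp, h⟩ := exists_monic_toLaurent_smul_eq_zero N
    (Submodule.fg_span (S.finite_toSet.image _)) hT
  exact ⟨p, hp, fun a ha => h _ (hmem a ha)⟩

theorem T_one_sub_one_ne_zero [Nontrivial R] : (T 1 - 1 : LaurentPolynomial R) ≠ 0 := by
  rw [← Polynomial.toLaurent_X, ← Polynomial.toLaurent_one, ← map_sub,
    Polynomial.toLaurent_ne_zero]
  simpa using Polynomial.X_sub_C_ne_zero (1 : R)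

theorem isTorsion_barHomology0 [IsDomain R] {s : G} (hs : (φ s).toAdd = 1) :
    Module.IsTorsion (LaurentPolynomial R) (barHomology0 R G φ) := by
  intro x
  obtain ⟨x, rfl⟩ := Submodule.Quotient.mk_surjective _ x
  refine ⟨⟨T 1 - 1, mem_nonZeroDivisors_of_ne_zero T_one_sub_one_ne_zero⟩, ?_⟩
  change (T 1 - 1 : LaurentPolynomial R) • (Submodule.Quotient.mk x : barHomology0 R G φ) = 0
  rw [← Submodule.Quotient.mk_smul, Submodule.Quotient.mk_eq_zero]
  exact ⟨Finsupp.single s x, by rw [barD1_single, hs, smul_eq_mul, sub_mul, one_mul]⟩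

theorem isTorsion_barHomology1 [IsDomain R] {s : G} (hs : (φ s).toAdd = 1) (hfg : φ.ker.FG) :
    Module.IsTorsion (LaurentPolynomial R) (barHomology1 R G φ) := by
  obtain ⟨p, hp, h⟩ := exists_monic_smul_barClass_eq_zero (R := R) hs hfg
  rintro ⟨_, c, hc, rfl⟩
  refine ⟨⟨p.toLaurent * (T 1 - 1), mem_nonZeroDivisors_of_ne_zero
    (mul_ne_zero (Polynomial.toLaurent_ne_zero.mpr hp.ne_zero) T_one_sub_one_ne_zero)⟩, ?_⟩
  exact Subtype.ext (T_sub_one_mul_smul_mk_eq_zero hs h hc)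

end Bar

/-- Let `R` be an integral domain and `G = A ⋊ ℤ` with `A` finitely generated, and let
`φ : G → ℤ` be the projection.  Then for every `k ≤ 1` the homology `H_k(G; R[t,t⁻¹])`
(of the bar complex, with `g` acting on `R[t,t⁻¹]` by multiplication by `t^{φ(g)}`) is
a torsion `R[t,t⁻¹]`-module. -/
theorem stmt9 (R : Type*) [CommRing R] [IsDomain R] (A : Type*) [Group A]
    (α : Multiplicative ℤ →* MulAut A) (hA : Group.FG A) :
    Module.IsTorsion (LaurentPolynomial R)
        (barHomology0 R (A ⋊[α] Multiplicative ℤ) SemidirectProduct.rightHom) ∧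
      Module.IsTorsion (LaurentPolynomial R)
        (barHomology1 R (A ⋊[α] Multiplicative ℤ) SemidirectProduct.rightHom) := by
  have hs : (SemidirectProduct.rightHom
      (SemidirectProduct.inr (.ofAdd 1) : A ⋊[α] Multiplicative ℤ)).toAdd = 1 := by simp
  refine ⟨isTorsion_barHomology0 hs, isTorsion_barHomology1 hs ?_⟩
  rw [← SemidirectProduct.range_inl_eq_ker_rightHom, ← Group.fg_iff_subgroup_fg]
  exact Group.fg_range _
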